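/- Let n ≥ 5 and let N be a perfect group of order n! whose center Z(N) has exactly two elements and with N/Z(N) isomorphic to Aₙ. Suppose f : Sₙ → Aut(N) is an injective group homomorphism and g : Sₙ → N is a bijective map satisfying g(στ) = g(σ) · f(σ)(g(τ)) for all σ, τ ∈ Sₙ, such that f(Aₙ) ⊆ Inn(N). Let ζ ∈ Sₙ be the unique element with g(ζ) equal to the nontrivial element of Z(N). Then ζ ∈ Aₙ, i.e., ζ is an even permutation. -/

import Mathlib

theorem aux_norm_le_cent {G : Type*} [Group G] [Finite G] (α : MulAut G)
    (hα : ∀ x, α x = x → x = 1) (p : ℕ) [Fact p.Prime]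
    (hc : ∀ P : Sylow p G, IsCyclic P) :
    ∃ Q : Sylow p G, Subgroup.normalizer (Q : Set G) ≤ Subgroup.centralizer (Q : Set G) := by
  have hinj : Function.Injective (fun u : G => (α u)⁻¹ * u) := by
    intro u v h
    simp only at h
    have : α (v * u⁻¹) = v * u⁻¹ := by
      rw [map_mul, map_inv]
      calc α v * (α u)⁻¹ = α v * ((α u)⁻¹ * u) * u⁻¹ := by group
        _ = v * u⁻¹ := by rw [h]; group
    have := hα _ this
    exact (mul_inv_eq_one.mp this).symm
  have hsurj := Finite.surjective_of_injective hinj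
  obtain ⟨P⟩ : Nonempty (Sylow p G) := inferInstance
  obtain ⟨g, hg⟩ := MulAction.exists_smul_eq G P (α • P)
  obtain ⟨u, hu⟩ := hsurj g
  simp only at hu
  have key : α • (u • P) = u • P := by
    have h1 : α • (u • P) = (α u) • (α • P) := by
      rw [Sylow.smul_def, Sylow.smul_def, smul_smul, smul_smul]
      congr 1
      ext x
      simp
    rw [h1, ← hg, smul_smul, ← hu]; simp
  generalize u • P = Q at key
  have hQ : ∀ y ∈ Q, α y ∈ Q := fun y hy => by
    rw [← key]
    exact Subgroup.smul_mem_pointwise_smul y α Q hy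
  have hQ' : ∀ y ∈ Q, ∃ x ∈ Q, α x = y := fun y hy => by
    rw [← key] at hy
    exact (Subgroup.mem_smul_pointwise_iff_exists y α Q).mp hy
  refine ⟨Q, ?_⟩
  obtain ⟨⟨x, hx⟩, hgen⟩ := (hc Q).exists_generator
  have hgen' : ∀ y ∈ Q, ∃ k : ℤ, x ^ k = y := fun y hy => by
    obtain ⟨k, hk⟩ := hgen ⟨y, hy⟩
    exact ⟨k, congrArg Subtype.val hk⟩
  intro m hm
  have hd : m⁻¹ * α m ∈ Subgroup.centralizer (Q : Set G) := by
    obtain ⟨k, hk⟩ := hgen' _ (hQ x hx)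
    obtain ⟨j, hj⟩ := hgen' (m * x * m⁻¹) ((Subgroup.mem_normalizer_iff.mp hm x).mp hx)
    have h1 : Commute (m⁻¹ * α m) (α x) := by
      have e1 : α m * α x * (α m)⁻¹ = m * α x * m⁻¹ := by
        rw [← map_mul, ← map_inv, ← map_mul, ← hj, map_zpow, ← hk, ← conj_zpow, ← hj,
          ← zpow_mul, ← zpow_mul, mul_comm]
      change m⁻¹ * α m * α x = α x * (m⁻¹ * α m)
      have e2 : α m * α x = m * α x * m⁻¹ * α m := by rw [← e1]; group
      rw [mul_assoc, e2]; group
    rw [Subgroup.mem_centralizer_iff]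
    intro y hy
    obtain ⟨z, hz, rfl⟩ := hQ' y hy
    obtain ⟨i, rfl⟩ := hgen' z hz
    rw [map_zpow]
    exact (h1.zpow_right i).symm
  have hC : ∀ c ∈ Subgroup.centralizer (Q : Set G), α c ∈ Subgroup.centralizer (Q : Set G) := by
    intro c hc
    rw [Subgroup.mem_centralizer_iff] at hc ⊢
    intro y hy
    obtain ⟨z, hz, rfl⟩ := hQ' y hy
    rw [← map_mul, ← map_mul, hc z hz]
  let F : Subgroup.centralizer (Q : Set G) → Subgroup.centralizer (Q : Set G) :=
    fun c => ⟨(α c)⁻¹ * c, mul_mem (inv_mem (hC c c.2)) c.2⟩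
  have hF : Function.Injective F := fun a b h =>
    Subtype.ext (hinj (congrArg Subtype.val h))
  obtain ⟨c, hc'⟩ := Finite.surjective_of_injective hF ⟨_, inv_mem hd⟩
  have h3 : (α c)⁻¹ * (c : G) = (α m)⁻¹ * m := by
    have := congrArg Subtype.val hc'
    simpa [F] using this
  have h4 : (c : G) = m := hinj h3
  rw [← h4]; exact c.2

theorem aux_no_fpf {G : Type*} [Group G] [Finite G] [IsSimpleGroup G] (p : ℕ) [Fact p.Prime]
    (hc : ∀ P : Sylow p G, Nat.card P = p) (hG : Nat.card G ≠ p) (α : MulAut G)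
    (hα : ∀ x, α x = x → x = 1) : False := by
  obtain ⟨Q, hQ⟩ := aux_norm_le_cent α hα p (fun P => isCyclic_of_prime_card (hc P))
  have h := MonoidHom.ker_transferSylow_isComplement' Q hQ
  have h2 := h.card_mul_card
  have hp := (Fact.out : p.Prime).one_lt
  rw [hc Q] at h2
  rcases (MonoidHom.normal_ker (MonoidHom.transferSylow Q hQ)).eq_bot_or_eq_top with h3 | h3
  · rw [h3] at h2
    simp at h2
    exact hG h2.symm
  · rw [h3] at h2
    have : 0 < Nat.card G := Nat.card_pos
    rw [Subgroup.card_top] at h2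
    nlinarith

theorem aux_prime (n : ℕ) (hn : 5 ≤ n) : ∃ p, p.Prime ∧ 2 < p ∧ n.factorial.factorization p = 1 := by
  obtain ⟨p, hp, h1, h2⟩ := Nat.exists_prime_lt_and_le_two_mul (n / 2) (by omega)
  refine ⟨p, hp, by omega, ?_⟩
  have hn0 : n ≠ 0 := by omega
  rw [Nat.factorization_factorial hp (b := 2)]
  · simp
    exact Nat.div_eq_of_lt_le (by omega) (by omega)
  · apply Nat.log_lt_of_lt_pow hn0
    nlinarith [Nat.div_add_mod n 2, Nat.mod_lt n two_pos]

theorem aux_alt (n : ℕ) (hn : 5 ≤ n) (α : MulAut (alternatingGroup (Fin n)))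
    (hα : ∀ x, α x = x → x = 1) : False := by
  obtain ⟨p, hp, h2, hf⟩ := aux_prime n hn
  have : Fact p.Prime := ⟨hp⟩
  have : Nontrivial (Fin n) := Fin.nontrivial_iff_two_le.mpr (by omega)
  have : IsSimpleGroup (alternatingGroup (Fin n)) := alternatingGroup.isSimpleGroup (by simpa)
  have hcard := two_mul_nat_card_alternatingGroup (α := Fin n)
  rw [Nat.card_perm, Nat.card_fin] at hcard
  have h0 : Nat.card (alternatingGroup (Fin n)) ≠ 0 := Nat.card_pos.ne'
  have hf2 : (Nat.card (alternatingGroup (Fin n))).factorization p = 1 := by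
    rw [← hcard, Nat.factorization_mul two_ne_zero h0] at hf
    have : (2:ℕ).factorization p = 0 := Nat.factorization_eq_zero_of_lt h2
    simpa [this] using hf
  refine aux_no_fpf p (fun P => ?_) ?_ α hα
  · rw [P.card_eq_multiplicity, hf2, pow_one]
  · intro h
    have : 60 ≤ Nat.card (alternatingGroup (Fin n)) := by
      have := Nat.factorial_le hn
      have h5 : Nat.factorial 5 = 120 := rfl
      omega
    have h3 : (3:ℕ) ∣ p := by
      have : 3 * 2 ∣ n.factorial := (by decide : 3 * 2 ∣ Nat.factorial 5).trans (Nat.factorial_dvd_factorial hn)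
      rw [← hcard, h] at this
      omega
    have := (Nat.prime_dvd_prime_iff_eq Nat.prime_three hp).mp h3
    omega

theorem stmt_11 (n : ℕ) (hn : 5 ≤ n) (N : Type*) [Group N]
    (hcard : Nat.card N = n.factorial) (hperf : commutator N = ⊤)
    (hZ : Nat.card (Subgroup.center N) = 2)
    (hquot : Nonempty ((N ⧸ Subgroup.center N) ≃* alternatingGroup (Fin n)))
    (f : Equiv.Perm (Fin n) →* MulAut N) (hf : Function.Injective f)
    (g : Equiv.Perm (Fin n) → N) (hg : Function.Bijective g)
    (hfg : ∀ σ τ : Equiv.Perm (Fin n), g (σ * τ) = g σ * f σ (g τ))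
    (hinn : ∀ σ ∈ alternatingGroup (Fin n), f σ ∈ (MulAut.conj (G := N)).range)
    (ζ : Equiv.Perm (Fin n)) (hζc : g ζ ∈ Subgroup.center N) (hζ1 : g ζ ≠ 1) :
    ζ ∈ alternatingGroup (Fin n) := by
  by_contra hodd
  obtain ⟨e⟩ := hquot
  have : Nontrivial (Fin n) := Fin.nontrivial_iff_two_le.mpr (by omega)
  have : IsSimpleGroup (alternatingGroup (Fin n)) := alternatingGroup.isSimpleGroup (by simpa)
  have hcardA := two_mul_nat_card_alternatingGroup (α := Fin n)
  rw [Nat.card_perm, Nat.card_fin] at hcardA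
  have hmk : ∀ a b : N, MulAut.conj a = MulAut.conj b →
      (a : N ⧸ Subgroup.center N) = b := by
    intro a b h
    rw [QuotientGroup.eq, Subgroup.mem_center_iff]
    intro x
    have := DFunLike.congr_fun h x
    simp only [MulAut.conj_apply] at this
    calc x * (a⁻¹ * b) = a⁻¹ * (a * x * a⁻¹) * b := by group
      _ = a⁻¹ * b * x := by rw [this]; group
  have hmk' : ∀ a b : N, (a : N ⧸ Subgroup.center N) = b → MulAut.conj a = MulAut.conj b := by
    intro a b h
    rw [QuotientGroup.eq, Subgroup.mem_center_iff] at h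
    ext x
    simp only [MulAut.conj_apply]
    calc a * x * a⁻¹ = a * (x * (a⁻¹ * b)) * b⁻¹ := by group
      _ = b * x * b⁻¹ := by rw [h]; group
  have hg1 : g 1 = 1 := by
    have := hfg 1 1
    simpa using this
  choose m hm using fun σ : alternatingGroup (Fin n) => hinn σ σ.2
  have hinj : ∀ σ τ : alternatingGroup (Fin n),
      (g σ : N ⧸ Subgroup.center N) = g τ → σ = τ := by
    intro σ τ h
    rw [QuotientGroup.eq] at h
    obtain ⟨y, hy, hyu⟩ := (Nat.card_eq_two_iff' (1 : Subgroup.center N)).mp hZ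
    by_cases h1 : (g σ)⁻¹ * g τ = 1
    · exact Subtype.ext (hg.1 (inv_mul_eq_one.mp h1))
    · exfalso
      have e1 := hyu ⟨_, h⟩ (fun h' => h1 (congrArg Subtype.val h'))
      have e2 := hyu ⟨_, hζc⟩ (fun h' => hζ1 (congrArg Subtype.val h'))
      have e3 : (g σ)⁻¹ * g τ = g ζ := congrArg Subtype.val (e1.trans e2.symm)
      have e4 : g τ = g (σ * ζ) := by
        rw [hfg, ← hm σ, MulAut.conj_apply, Subgroup.mem_center_iff.mp hζc (m σ), ← e3]
        group
      have e5 := hg.1 e4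
      apply hodd
      have : ζ = (σ : Equiv.Perm (Fin n))⁻¹ * τ := by rw [e5]; group
      rw [this]
      exact mul_mem (inv_mem σ.2) τ.2
  have hmm : ∀ σ τ, (m (σ * τ) : N ⧸ Subgroup.center N) = m σ * m τ := by
    intro σ τ
    rw [← QuotientGroup.mk_mul]
    apply hmk
    rw [map_mul, hm, hm, hm, Subgroup.coe_mul, map_mul]
  let φ : alternatingGroup (Fin n) →* N ⧸ Subgroup.center N :=
    MonoidHom.mk' (fun σ => (m σ : N ⧸ Subgroup.center N)) hmm
  let h : alternatingGroup (Fin n) →* N ⧸ Subgroup.center N :=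
    MonoidHom.mk' (fun σ => (g σ : N ⧸ Subgroup.center N) * m σ) (by
      intro σ τ
      rw [hmm, Subgroup.coe_mul, hfg, ← hm σ, MulAut.conj_apply]
      simp only [QuotientGroup.mk_mul, QuotientGroup.mk_inv]
      group)
  have hφ : Function.Injective φ := by
    intro σ τ hst
    have := hmk' _ _ hst
    rw [hm, hm] at this
    exact Subtype.ext (hf this)
  have : Finite (N ⧸ Subgroup.center N) := Finite.of_equiv _ e.symm.toEquiv
  have hbij : ∀ k : alternatingGroup (Fin n) →* N ⧸ Subgroup.center N,
      Function.Injective k → Function.Bijective k := fun k hk =>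
    (Nat.bijective_iff_injective_and_card k).mpr ⟨hk, (Nat.card_congr e.toEquiv).symm⟩
  rcases (MonoidHom.normal_ker h).eq_bot_or_eq_top with hk | hk
  · have hh : Function.Injective h := (MonoidHom.ker_eq_bot_iff h).mp hk
    let α : MulAut (alternatingGroup (Fin n)) :=
      (MulEquiv.ofBijective h (hbij h hh)).trans (MulEquiv.ofBijective φ (hbij φ hφ)).symm
    refine aux_alt n hn α fun x hx => hinj x 1 ?_
    have h1 : h x = φ x := by
      exact (MulEquiv.symm_apply_eq (MulEquiv.ofBijective φ (hbij φ hφ))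
        (x := h x) (y := x)).mp hx
    have h2 : (g x : N ⧸ Subgroup.center N) * m x = m x := h1
    rw [mul_eq_right] at h2
    rw [h2]; simp [hg1]
  · have hh : ∀ σ τ : alternatingGroup (Fin n), g (σ * τ) = g τ * g σ := by
      intro σ τ
      have h1 : h σ = 1 := by
        have : σ ∈ h.ker := hk ▸ Subgroup.mem_top σ
        exact this
      have h2 : (g σ : N ⧸ Subgroup.center N) * m σ = 1 := h1
      have h3 : (m σ : N ⧸ Subgroup.center N) = ((g σ)⁻¹ : N) := by
        rw [QuotientGroup.mk_inv]; exact eq_inv_of_mul_eq_one_right h2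
      rw [hfg, ← hm σ, hmk' _ _ h3, MulAut.conj_apply]
      group
    let k : alternatingGroup (Fin n) →* N :=
      MonoidHom.mk' (fun σ => (g σ)⁻¹) (by
        intro σ τ
        rw [Subgroup.coe_mul, hh, mul_inv_rev])
    have hkinj : Function.Injective k := fun σ τ hst => Subtype.ext (hg.1 (inv_injective hst))
    have hkc : Nat.card k.range = Nat.card (alternatingGroup (Fin n)) :=
      (Nat.card_congr (MonoidHom.ofInjective hkinj).toEquiv).symm
    have hidx : k.range.index = 2 := by
      have h1 := k.range.card_mul_index
      rw [hcard, ← hcardA, hkc, mul_comm] at h1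
      exact Nat.eq_of_mul_eq_mul_right Nat.card_pos h1
    have hnorm : k.range.Normal := Subgroup.normal_of_index_eq_two hidx
    have : Fact (Nat.Prime 2) := ⟨Nat.prime_two⟩
    have hcyc : IsCyclic (N ⧸ k.range) := isCyclic_of_prime_card (p := 2) hidx
    have hle : commutator N ≤ k.range := by
      rw [← hnorm.quotient_commutative_iff_commutator_le]
      exact IsCyclic.isMulCommutative
    rw [hperf, top_le_iff] at hle
    rw [hle, Subgroup.index_top] at hidx
    omega
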